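/- arXiv:1809.09158 — 2 statements merged into one kernel-verified Lean document; each statement's English description precedes it below -/
import Mathlib

section
/- Let c = (c₁,…,c_n), where c₁,…,c_n are positive integers. For every word w ∈ W_c, one has ⟨w⟩_fast ≤ n − 1 and ⟨w⟩_slow ≤ c₂ + c₃ + ⋯ + c_n. -/
lemma foldr_max_mem {w : List ℕ} (h : w ≠ []) : w.foldr max 0 ∈ w := by
  induction w with
  | nil => exact absurd rfl h
  | cons a l ih =>
    rcases eq_or_ne l [] with rfl | hl
    · simp
    · have hm := ih hl
      simp only [List.foldr_cons]
      rcases max_choice a (l.foldr max 0) with h' | h' <;> rw [h']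
      · exact List.mem_cons_self
      · exact List.mem_cons_of_mem _ hm

lemma headI_mem {α : Type*} [Inhabited α] {l : List α} (h : l ≠ []) : l.headI ∈ l := by
  cases l with
  | nil => exact absurd rfl h
  | cons a t => simp

/-- `blocks n w` is the list of maximal (possibly empty) blocks of `w`
separated by occurrences of the letter `n`; that is, if `n` occurs `k` times
in `w`, then `blocks n w = [A₁, A₂, …, A_{k+1}]` where `w = A₁ n A₂ n ⋯ n A_{k+1}`
and no `Aᵢ` contains the letter `n`. -/
def blocks (n : ℕ) : List ℕ → List (List ℕ)
  | [] => [[]]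
  | a :: l =>
    if a = n then [] :: blocks n l
    else (a :: (blocks n l).headI) :: (blocks n l).tail

lemma blocks_ne_nil (n : ℕ) (w : List ℕ) : blocks n w ≠ [] := by
  cases w with
  | nil => simp [blocks]
  | cons a l =>
    simp only [blocks]
    split <;> simp

lemma blocks_length {n : ℕ} {w : List ℕ} : ∀ {A : List ℕ}, A ∈ blocks n w →
    A.length + w.count n ≤ w.length := by
  induction w with
  | nil =>
    intro A hA
    simp only [blocks, List.mem_singleton] at hA
    subst hA; simp
  | cons a l ih =>
    intro A hA
    by_cases h : a = n
    · subst h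
      simp only [blocks, if_pos rfl] at hA
      have hcc : (a :: l).count a = l.count a + 1 := by simp
      cases hA with
      | head =>
        have := List.count_le_length (a := a) (l := l)
        simp only [List.length_nil, List.length_cons, hcc]
        omega
      | tail _ h1 =>
        have := ih h1
        simp only [List.length_cons, hcc]
        omega
    · simp only [blocks, if_neg h] at hA
      have hcc : (a :: l).count n = l.count n := by
        simp [List.count_cons, h]
      cases hA with
      | head =>
        have := ih (headI_mem (blocks_ne_nil n l))
        simp only [List.length_cons, hcc]
        omega
      | tail _ h1 =>
        have := ih (List.mem_of_mem_tail h1)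
        simp only [List.length_cons, hcc]
        omega

/-- The generalized stack-sorting map `fast` (the convention in which a letter may
sit on top of a copy of itself in the stack): `fast ε = ε`, and if
`w = A₁ n A₂ n ⋯ n A_{k+1}` where `n` is the largest letter of `w` (occurring
`k` times) and the `Aᵢ` contain only letters smaller than `n`, then
`fast w = fast A₁ ++ fast A₂ ++ ⋯ ++ fast A_{k+1} ++ n ⋯ n` (with `k` copies of `n`). -/
def fast (w : List ℕ) : List ℕ :=
  if h : w = [] then []
  else
    ((blocks (w.foldr max 0) w).attach.map
      fun (A : {x // x ∈ blocks (w.foldr max 0) w}) =>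
      have : A.1.length < w.length := by
        have h1 := blocks_length A.2
        have h2 : 0 < w.count (w.foldr max 0) :=
          List.count_pos_iff.mpr (foldr_max_mem h)
        omega
      fast A.1).flatten ++ List.replicate (w.count (w.foldr max 0)) (w.foldr max 0)
termination_by w.length

/-- The generalized stack-sorting map `slow` (the convention in which a letter may
not sit on top of a copy of itself in the stack): `slow ε = ε`, and if
`w = A₁ n A₂ n ⋯ n A_{k+1}` where `n` is the largest letter of `w` (occurring
`k` times) and the `Aᵢ` contain only letters smaller than `n`, then
`slow w = slow A₁ ++ slow A₂ ++ [n] ++ slow A₃ ++ [n] ++ ⋯ ++ slow A_{k+1} ++ [n]`. -/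
def slow (w : List ℕ) : List ℕ :=
  if h : w = [] then []
  else
    (have : (blocks (w.foldr max 0) w).headI.length < w.length := by
      have h1 := blocks_length (headI_mem (blocks_ne_nil (w.foldr max 0) w))
      have h2 : 0 < w.count (w.foldr max 0) :=
        List.count_pos_iff.mpr (foldr_max_mem h)
      omega
     slow (blocks (w.foldr max 0) w).headI) ++
    ((blocks (w.foldr max 0) w).tail.attach.map
      fun (A : {x // x ∈ (blocks (w.foldr max 0) w).tail}) =>
      have : A.1.length < w.length := by
        have h1 := blocks_length (List.mem_of_mem_tail A.2)
        have h2 : 0 < w.count (w.foldr max 0) :=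
          List.count_pos_iff.mpr (foldr_max_mem h)
        omega
      slow A.1 ++ [w.foldr max 0]).flatten
termination_by w.length

/-- Membership in `W_c`: `w` is a word over the positive integers with exactly
`cᵢ` copies of the letter `i` for each `1 ≤ i ≤ n = c.length` (and no other letters). -/
def InW (c : List ℕ) (w : List ℕ) : Prop :=
  0 ∉ w ∧ ∀ i : ℕ, w.count (i + 1) = c.getD i 0

/-- The identity word `Id_c = 1^{c₁} 2^{c₂} ⋯ n^{c_n}`, the unique word in `W_c`
whose letters are nondecreasing from left to right. -/
def idWord (c : List ℕ) : List ℕ :=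
  ((List.range c.length).map fun i => List.replicate (c.getD i 0) (i + 1)).flatten

lemma blocks_append_singleton (m : ℕ) (v : List ℕ) :
    blocks m (v ++ [m]) = blocks m v ++ [[]] := by
  induction v with
  | nil => simp [blocks]
  | cons a l ih =>
    obtain ⟨b, t, hb⟩ := List.exists_cons_of_ne_nil (blocks_ne_nil m l)
    by_cases h : a = m <;> simp [blocks, h, ih, hb]

lemma blocks_of_notMem {m : ℕ} {v : List ℕ} (h : m ∉ v) : blocks m v = [v] := by
  induction v with
  | nil => simp [blocks]
  | cons a l ih =>
    simp only [List.mem_cons, not_or] at h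
    simp [blocks, Ne.symm h.1, ih h.2]

lemma tail_blocks_ne_nil {m : ℕ} {v : List ℕ} (h : m ∈ v) : (blocks m v).tail ≠ [] := by
  induction v with
  | nil => simp at h
  | cons a l ih =>
    by_cases ha : a = m
    · simpa [blocks, ha] using blocks_ne_nil m l
    · simpa [blocks, ha] using ih (by simpa [Ne.symm ha] using h)

lemma count_flatten_blocks (m x : ℕ) (v : List ℕ) :
    (blocks m v).flatten.count x + (List.replicate (v.count m) m).count x = v.count x := by
  induction v with
  | nil => simp [blocks]
  | cons a l ih =>
    obtain ⟨b, t, hb⟩ := List.exists_cons_of_ne_nil (blocks_ne_nil m l)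
    by_cases h : a = m
    · subst h
      simp only [blocks, if_true, List.flatten_cons, List.nil_append, List.count_replicate,
        List.count_cons, beq_iff_eq] at ih ⊢
      split_ifs at * <;> omega
    · simp only [blocks, h, if_false, hb, List.flatten_cons, List.headI_cons, List.tail_cons,
        List.cons_append, List.count_replicate, List.count_cons, List.count_append,
        beq_iff_eq] at ih ⊢
      split_ifs at * <;> omega

lemma flatten_blocks_perm (m : ℕ) (v : List ℕ) :
    ((blocks m v).flatten ++ List.replicate (v.count m) m).Perm v :=
  List.perm_iff_count.2 fun x => by rw [List.count_append, count_flatten_blocks]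

lemma length_blocks_tail (m : ℕ) (v : List ℕ) : (blocks m v).tail.length = v.count m := by
  induction v with
  | nil => simp [blocks]
  | cons a l ih =>
    obtain ⟨b, t, hb⟩ := List.exists_cons_of_ne_nil (blocks_ne_nil m l)
    by_cases h : a = m <;> simp_all [blocks]

lemma foldr_max_eq {m : ℕ} {v : List ℕ} (hv : ∀ x ∈ v, x ≤ m) (h : m ∈ v) :
    v.foldr max 0 = m := by
  apply le_antisymm (hv _ (foldr_max_mem (List.ne_nil_of_mem h)))
  clear hv
  induction v with
  | nil => simp at h
  | cons a l ih =>
    rcases List.mem_cons.1 h with rfl | h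
    · simp
    · exact le_max_of_le_right (ih h)

lemma le_foldr_max {v : List ℕ} {x : ℕ} (h : x ∈ v) : x ≤ v.foldr max 0 := by
  induction v with
  | nil => simp at h
  | cons a l ih =>
    rcases List.mem_cons.1 h with rfl | h
    · simp
    · exact le_max_of_le_right (ih h)

lemma fast_nil : fast [] = [] := by rw [fast]; simp

lemma slow_nil : slow [] = [] := by rw [slow]; simp

lemma fast_eq {m : ℕ} {v : List ℕ} (hv : ∀ x ∈ v, x ≤ m) :
    fast v = ((blocks m v).map fast).flatten ++ List.replicate (v.count m) m := by
  by_cases h : m ∈ v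
  · obtain rfl := foldr_max_eq hv h
    rw [fast, dif_neg (List.ne_nil_of_mem h)]
    simp only [List.map_attach_eq_pmap, List.pmap_eq_map]
  · simp [blocks_of_notMem h, List.count_eq_zero.2 h]

lemma slow_eq {m : ℕ} {v : List ℕ} (hv : ∀ x ∈ v, x ≤ m) :
    slow v = slow (blocks m v).headI ++
      ((blocks m v).tail.map fun A => slow A ++ [m]).flatten := by
  by_cases h : m ∈ v
  · obtain rfl := foldr_max_eq hv h
    rw [slow, dif_neg (List.ne_nil_of_mem h)]
    simp only [List.map_attach_eq_pmap, List.pmap_eq_map]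
  · simp [blocks_of_notMem h]

lemma length_lt_of_mem_blocks {v : List ℕ} (h : v ≠ []) {A : List ℕ}
    (hA : A ∈ blocks (v.foldr max 0) v) : A.length < v.length := by
  have h1 := blocks_length hA
  have h2 : 0 < v.count (v.foldr max 0) := List.count_pos_iff.mpr (foldr_max_mem h)
  omega

lemma flatten_map_perm {f : List ℕ → List ℕ} {L : List (List ℕ)}
    (h : ∀ A ∈ L, (f A).Perm A) : (L.map f).flatten.Perm L.flatten := by
  induction L with
  | nil => simp
  | cons A L ih =>
    simpa using (h A (by simp)).append (ih fun B hB => h B (by simp [hB]))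

lemma flatten_map_append_singleton_perm (f : List ℕ → List ℕ) (m : ℕ) (L : List (List ℕ)) :
    (L.map fun A => f A ++ [m]).flatten.Perm
      ((L.map f).flatten ++ List.replicate L.length m) := by
  rw [List.perm_iff_count]
  intro x
  induction L with
  | nil => simp
  | cons A L ih =>
    simp only [List.map_cons, List.flatten_cons, List.count_append, List.length_cons,
      List.count_replicate, List.count_cons, List.count_nil, beq_iff_eq] at ih ⊢
    split_ifs at * <;> omega

lemma fast_perm (v : List ℕ) : (fast v).Perm v := by
  induction hn : v.length using Nat.strong_induction_on generalizing v with
  | _ n ih =>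
    rcases eq_or_ne v [] with rfl | h
    · simp [fast_nil]
    · rw [fast_eq (fun x hx => le_foldr_max hx)]
      refine List.Perm.trans (List.Perm.append_right _ (flatten_map_perm fun A hA => ?_))
        (flatten_blocks_perm _ v)
      exact ih _ (hn ▸ length_lt_of_mem_blocks h hA) A rfl

lemma slow_perm (v : List ℕ) : (slow v).Perm v := by
  induction hn : v.length using Nat.strong_induction_on generalizing v with
  | _ n ih =>
    rcases eq_or_ne v [] with rfl | h
    · simp [slow_nil]
    · rw [slow_eq (fun x hx => le_foldr_max hx)]
      have key : ((blocks (v.foldr max 0) v).map slow).flatten.Perm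
          (blocks (v.foldr max 0) v).flatten :=
        flatten_map_perm fun A hA => ih _ (hn ▸ length_lt_of_mem_blocks h hA) A rfl
      refine List.Perm.trans ?_ ((key.append_right _).trans (flatten_blocks_perm _ v))
      rw [← length_blocks_tail]
      obtain ⟨b, t, hb⟩ := List.exists_cons_of_ne_nil (blocks_ne_nil (v.foldr max 0) v)
      rw [hb]
      simpa using (flatten_map_append_singleton_perm slow _ t).append_left (slow b)

lemma fast_append_singleton {m : ℕ} {v : List ℕ} (hv : ∀ x ∈ v, x ≤ m) :
    fast (v ++ [m]) = fast v ++ [m] := by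
  have hv' : ∀ x ∈ v ++ [m], x ≤ m := by
    simpa [or_imp, forall_and] using hv
  rw [fast_eq hv, fast_eq hv', blocks_append_singleton]
  simp [fast_nil, List.replicate_succ']

lemma slow_append_singleton {m : ℕ} {v : List ℕ} (hv : ∀ x ∈ v, x ≤ m) :
    slow (v ++ [m]) = slow v ++ [m] := by
  have hv' : ∀ x ∈ v ++ [m], x ≤ m := by
    simpa [or_imp, forall_and] using hv
  rw [slow_eq hv, slow_eq hv', blocks_append_singleton]
  obtain ⟨b, t, hb⟩ := List.exists_cons_of_ne_nil (blocks_ne_nil m v)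
  simp [hb, slow_nil]

lemma slow_eq_append_singleton {m : ℕ} {v : List ℕ} (hv : ∀ x ∈ v, x ≤ m) (h : m ∈ v) :
    ∃ u, slow v = u ++ [m] := by
  rw [slow_eq hv, ← List.dropLast_append_getLast (tail_blocks_ne_nil h)]
  simp only [List.map_append, List.flatten_append, List.map_cons, List.map_nil,
    List.flatten_cons, List.flatten_nil, List.append_nil, ← List.append_assoc]
  exact ⟨_, rfl⟩

lemma iterate_perm {f : List ℕ → List ℕ} (hperm : ∀ v, (f v).Perm v) (k : ℕ) (v : List ℕ) :
    (f^[k] v).Perm v := by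
  induction k with
  | zero => simp
  | succ k ih => rw [Function.iterate_succ_apply']; exact (hperm _).trans ih

lemma iterate_append_replicate {f : List ℕ → List ℕ} (hperm : ∀ v, (f v).Perm v)
    (happ : ∀ m v, (∀ x ∈ v, x ≤ m) → f (v ++ [m]) = f v ++ [m])
    {m : ℕ} {v : List ℕ} (hv : ∀ x ∈ v, x ≤ m) (k j : ℕ) :
    f^[k] (v ++ List.replicate j m) = f^[k] v ++ List.replicate j m := by
  have step : ∀ u : List ℕ, (∀ x ∈ u, x ≤ m) → ∀ j,
      f (u ++ List.replicate j m) = f u ++ List.replicate j m := by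
    intro u hu j
    induction j with
    | zero => simp
    | succ j ih =>
      rw [List.replicate_succ', ← List.append_assoc, happ, ih, List.append_assoc]
      intro x hx
      rcases List.mem_append.1 hx with h | h
      · exact hu x h
      · exact (List.eq_of_mem_replicate h).le
  induction k with
  | zero => simp
  | succ k ih =>
    rw [Function.iterate_succ_apply', ih, step, Function.iterate_succ_apply']
    exact fun x hx => hv x ((iterate_perm hperm k v).mem_iff.1 hx)

lemma exists_fast_eq_append_replicate {m : ℕ} {v : List ℕ} (hv : ∀ x ∈ v, x ≤ m) :
    ∃ u, fast v = u ++ List.replicate (v.count m) m :=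
  ⟨_, fast_eq hv⟩

lemma exists_slow_iterate_eq_append_replicate {m : ℕ} (k : ℕ) {v : List ℕ}
    (hv : ∀ x ∈ v, x ≤ m) (hk : v.count m = k) :
    ∃ u, slow^[k] v = u ++ List.replicate k m := by
  induction k generalizing v with
  | zero => exact ⟨v, by simp⟩
  | succ k ih =>
    obtain ⟨u, hu⟩ := slow_eq_append_singleton hv (List.count_pos_iff.1 (by omega))
    have hp : (u ++ [m]).Perm v := hu ▸ slow_perm v
    have hum : ∀ x ∈ u, x ≤ m := fun x hx => hv x (hp.mem_iff.1 (by simp [hx]))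
    have hc : u.count m = k := by
      have := hp.count_eq m
      rw [List.count_append, List.count_singleton_self] at this
      omega
    obtain ⟨u', hu'⟩ := ih hum hc
    refine ⟨u', ?_⟩
    have := iterate_append_replicate slow_perm (fun _ _ => slow_append_singleton) hum k 1
    rw [List.replicate_one] at this
    rw [Function.iterate_succ_apply, hu, this, hu', List.replicate_succ', List.append_assoc]

/-- If `g k` applications of `f` move the `k` copies of the largest letter to the end, then
`∑ i ∈ range n, g kᵢ₊₂` applications sort a word over `{1, …, n + 1}` with `kᵢ` copies of `i`. -/
lemma pairwise_iterate {f : List ℕ → List ℕ} (hperm : ∀ v, (f v).Perm v)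
    (happ : ∀ m v, (∀ x ∈ v, x ≤ m) → f (v ++ [m]) = f v ++ [m]) (g : ℕ → ℕ)
    (hg : ∀ m v, (∀ x ∈ v, x ≤ m) →
      ∃ u, f^[g (v.count m)] v = u ++ List.replicate (v.count m) m)
    (n : ℕ) (v : List ℕ) (h0 : 0 ∉ v) (hv : ∀ x ∈ v, x ≤ n + 1) :
    (f^[∑ i ∈ Finset.range n, g (v.count (i + 2))] v).Pairwise (· ≤ ·) := by
  induction n generalizing v with
  | zero =>
    have : v = List.replicate v.length 1 := List.eq_replicate_iff.2 ⟨rfl, fun x hx => by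
      have := hv x hx
      have : x ≠ 0 := fun h => h0 (h ▸ hx)
      omega⟩
    rw [Finset.range_zero, Finset.sum_empty, Function.iterate_zero, id, this]
    exact List.pairwise_replicate.2 (Or.inr le_rfl)
  | succ n ih =>
    obtain ⟨u, hu⟩ := hg (n + 2) v hv
    have hp : (u ++ List.replicate (v.count (n + 2)) (n + 2)).Perm v := hu ▸ iterate_perm hperm _ v
    have huv : ∀ x ∈ u, x ∈ v := fun x hx => hp.mem_iff.1 (by simp [hx])
    have hcount : ∀ x, u.count x + (if n + 2 = x then v.count (n + 2) else 0) = v.count x := by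
      intro x
      rw [← hp.count_eq x, List.count_append, List.count_replicate]
      simp
    have hlt : ∀ x ∈ u, x ≤ n + 1 := by
      intro x hx
      have h1 := hv x (huv x hx)
      have h2 : x ≠ n + 2 := by
        rintro rfl
        have h3 := hcount (n + 2)
        have h4 := List.count_pos_iff.2 hx
        rw [if_pos rfl] at h3
        omega
      omega
    have hsum : ∑ i ∈ Finset.range n, g (v.count (i + 2)) =
        ∑ i ∈ Finset.range n, g (u.count (i + 2)) := by
      refine Finset.sum_congr rfl fun i hi => ?_
      have h1 := hcount (i + 2)
      rw [if_neg (by have := Finset.mem_range.1 hi; omega)] at h1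
      rw [← h1, Nat.add_zero]
    rw [Finset.sum_range_succ, Function.iterate_add_apply, hu, hsum,
      iterate_append_replicate hperm happ fun x hx => (hlt x hx).trans (Nat.le_succ _)]
    refine List.pairwise_append.2 ⟨ih u (fun h => h0 (huv 0 h)) hlt,
      List.pairwise_replicate.2 (Or.inr le_rfl), fun x hx y hy => ?_⟩
    rw [List.eq_of_mem_replicate hy]
    exact (hlt x ((iterate_perm hperm _ u).mem_iff.1 hx)).trans (Nat.le_succ _)

lemma pairwise_idWord (c : List ℕ) : (idWord c).Pairwise (· ≤ ·) := by
  rw [idWord, List.pairwise_flatten]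
  constructor
  · simp only [List.mem_map]
    rintro _ ⟨i, -, rfl⟩
    exact List.pairwise_replicate.2 (Or.inr le_rfl)
  · rw [List.pairwise_map]
    refine List.pairwise_lt_range.imp fun {a b} hab x hx y hy => ?_
    rw [List.eq_of_mem_replicate hx, List.eq_of_mem_replicate hy]
    omega

lemma count_idWord_succ (c : List ℕ) (j : ℕ) : (idWord c).count (j + 1) = c.getD j 0 := by
  have key : ∀ n, (((List.range n).map fun i =>
      List.replicate (c.getD i 0) (i + 1)).flatten).count (j + 1) =
      if j < n then c.getD j 0 else 0 := by
    intro n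
    induction n with
    | zero => simp
    | succ n ih =>
      rw [List.range_succ, List.map_append, List.flatten_append, List.count_append, ih]
      simp only [List.map_cons, List.map_nil, List.flatten_cons, List.flatten_nil,
        List.append_nil, List.count_replicate, beq_iff_eq, Nat.add_right_cancel_iff]
      rcases lt_trichotomy j n with h | rfl | h
      · simp [h, h.ne', h.trans (Nat.lt_succ_self n)]
      · simp
      · rw [if_neg (by omega), if_neg (by omega), if_neg (by omega)]
  rw [idWord, key]
  split_ifs with h
  · rfl
  · rw [List.getD_eq_default _ _ (not_lt.1 h)]

lemma perm_idWord {c w : List ℕ} (hw : InW c w) : w.Perm (idWord c) := by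
  refine List.perm_iff_count.2 fun x => ?_
  cases x with
  | zero =>
    rw [List.count_eq_zero.2 hw.1, List.count_eq_zero.2]
    simp [idWord]
  | succ j => rw [hw.2, count_idWord_succ]

lemma InW.le_length {c w : List ℕ} (hw : InW c w) {x : ℕ} (hx : x ∈ w) : x ≤ c.length := by
  by_contra! h
  obtain ⟨j, rfl⟩ : ∃ j, x = j + 1 := ⟨x - 1, by omega⟩
  have h1 := hw.2 j
  rw [List.getD_eq_default _ _ (by omega)] at h1
  exact List.count_eq_zero.1 h1 hx

lemma sum_drop_one (c : List ℕ) :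
    ∑ i ∈ Finset.range (c.length - 1), c.getD (i + 1) 0 = (c.drop 1).sum := by
  cases c with
  | nil => simp
  | cons a t =>
    simp only [List.length_cons, Nat.add_sub_cancel, List.getD_cons_succ, List.drop_succ_cons,
      List.drop_zero]
    induction t with
    | nil => simp
    | cons b t ih => simp [Finset.sum_range_succ', ← ih, Nat.add_comm]

lemma iterate_eq_idWord {f : List ℕ → List ℕ} (hperm : ∀ v, (f v).Perm v)
    (happ : ∀ m v, (∀ x ∈ v, x ≤ m) → f (v ++ [m]) = f v ++ [m]) (g : ℕ → ℕ)
    (hg : ∀ m v, (∀ x ∈ v, x ≤ m) →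
      ∃ u, f^[g (v.count m)] v = u ++ List.replicate (v.count m) m)
    {c w : List ℕ} (hw : InW c w) :
    f^[∑ i ∈ Finset.range (c.length - 1), g (c.getD (i + 1) 0)] w = idWord c := by
  have hsorted := pairwise_iterate hperm happ g hg (c.length - 1) w hw.1
    fun x hx => by have := hw.le_length hx; omega
  simp only [← hw.2]
  exact ((iterate_perm hperm _ w).trans (perm_idWord hw)).eq_of_pairwise
    (fun _ _ _ _ => le_antisymm) hsorted (pairwise_idWord c)

/-- Let `c = (c₁, …, c_n)`, where `c₁, …, c_n` are positive integers. For every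
`w ∈ W_c`, we have `⟨w⟩_fast ≤ n - 1` and `⟨w⟩_slow ≤ c₂ + c₃ + ⋯ + c_n`, where
`⟨w⟩_fast` (resp. `⟨w⟩_slow`) is the smallest nonnegative integer `k` with
`fast^[k] w = Id_c` (resp. `slow^[k] w = Id_c`). -/
theorem dist_fast_slow_le (c : List ℕ) (hc : ∀ x ∈ c, 0 < x)
    (w : List ℕ) (hw : InW c w) :
    (∃ k, fast^[k] w = idWord c) ∧
    sInf {k | fast^[k] w = idWord c} ≤ c.length - 1 ∧
    (∃ k, slow^[k] w = idWord c) ∧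
    sInf {k | slow^[k] w = idWord c} ≤ (c.drop 1).sum := by
  have hfast : fast^[c.length - 1] w = idWord c := by
    have := iterate_eq_idWord fast_perm (fun _ _ => fast_append_singleton) (fun _ => 1)
      (fun _ _ hv => exists_fast_eq_append_replicate hv) hw
    simpa only [Finset.sum_const, Finset.card_range, smul_eq_mul, mul_one] using this
  have hslow : slow^[(c.drop 1).sum] w = idWord c := by
    rw [← sum_drop_one]
    exact iterate_eq_idWord slow_perm (fun _ _ => slow_append_singleton) id
      (fun _ _ hv => exists_slow_iterate_eq_append_replicate _ hv rfl) hw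
  exact ⟨⟨_, hfast⟩, Nat.sInf_le hfast, ⟨_, hslow⟩, Nat.sInf_le hslow⟩
end

section
/- For every tree τ ∈ R (a weakly decreasing binary plane tree in which no vertex has the same label as its left child), one has fast(S(τ)) = P(τ); that is, applying fast to the in-order reading of τ yields the postorder reading of τ. -/
/-- Binary plane trees labeled by natural numbers: each vertex carries a label and
an ordered pair of (possibly empty) left and right subtrees. -/
inductive BTree where
  | leaf : BTree
  | node : BTree → ℕ → BTree → BTree

/-- The in-order (symmetric order) reading of a labeled binary plane tree. -/
def BTree.inOrder : BTree → List ℕ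
  | .leaf => []
  | .node l v r => l.inOrder ++ v :: r.inOrder

/-- The postorder reading of a labeled binary plane tree. -/
def BTree.postOrder : BTree → List ℕ
  | .leaf => []
  | .node l v r => l.postOrder ++ r.postOrder ++ [v]

/-- The label of the root of a binary plane tree, if the tree is nonempty. -/
def BTree.root? : BTree → Option ℕ
  | .leaf => none
  | .node _ v _ => some v

/-- The tree is weakly decreasing: the label of each nonroot vertex is at most
the label of its parent. -/
def BTree.WeaklyDecreasing : BTree → Prop
  | .leaf => True
  | .node l v r => (∀ x ∈ l.inOrder, x ≤ v) ∧ (∀ x ∈ r.inOrder, x ≤ v) ∧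
      l.WeaklyDecreasing ∧ r.WeaklyDecreasing

/-- All labels of the tree are positive integers. -/
def BTree.PosLabels : BTree → Prop
  | .leaf => True
  | .node l v r => 0 < v ∧ l.PosLabels ∧ r.PosLabels

/-- No vertex has the same label as its left child. -/
def BTree.NoLeftEq : BTree → Prop
  | .leaf => True
  | .node l v r => l.root? ≠ some v ∧ l.NoLeftEq ∧ r.NoLeftEq

/-- No vertex has the same label as its right child. -/
def BTree.NoRightEq : BTree → Prop
  | .leaf => True
  | .node l v r => r.root? ≠ some v ∧ l.NoRightEq ∧ r.NoRightEq

/-- `τ ∈ R`: a weakly decreasing binary plane tree (labeled by positive integers)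
in which no vertex has the same label as its left child. -/
def BTree.InR (t : BTree) : Prop := t.WeaklyDecreasing ∧ t.PosLabels ∧ t.NoLeftEq

/-- `τ ∈ L`: a weakly decreasing binary plane tree (labeled by positive integers)
in which no vertex has the same label as its right child. -/
def BTree.InL (t : BTree) : Prop := t.WeaklyDecreasing ∧ t.PosLabels ∧ t.NoRightEq

lemma foldr_max_eq_s6 {n : ℕ} {w : List ℕ} (hw : ∀ x ∈ w, x ≤ n) (hn : n ∈ w) :
    w.foldr max 0 = n :=
  le_antisymm (hw _ (foldr_max_mem (List.ne_nil_of_mem hn))) (List.le_max_of_le hn le_rfl)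

lemma blocks_of_notMem_s6 {n : ℕ} {w : List ℕ} (hn : n ∉ w) : blocks n w = [w] := by
  induction w with
  | nil => rfl
  | cons a l ih =>
    rw [List.mem_cons, not_or] at hn
    simp [blocks, Ne.symm hn.1, ih hn.2]

lemma blocks_append_cons {n : ℕ} {u : List ℕ} (hn : n ∉ u) (w : List ℕ) :
    blocks n (u ++ n :: w) = u :: blocks n w := by
  induction u with
  | nil => simp [blocks]
  | cons a l ih =>
    rw [List.mem_cons, not_or] at hn
    simp [blocks, Ne.symm hn.1, ih hn.2]

/-- The recursion for `fast` may be applied to any upper bound of the letters of `w`. -/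
lemma fast_eq_of_forall_le {n : ℕ} {w : List ℕ} (hw : ∀ x ∈ w, x ≤ n) :
    fast w = ((blocks n w).map fast).flatten ++ List.replicate (w.count n) n := by
  by_cases hn : n ∈ w
  · rw [fast, dif_neg (List.ne_nil_of_mem hn)]
    simp only [foldr_max_eq_s6 hw hn, List.map_subtype, List.unattach_attach]
  · simp [blocks_of_notMem_s6 hn, List.count_eq_zero_of_not_mem hn]

lemma fast_append_cons {n : ℕ} {u w : List ℕ} (hu : ∀ x ∈ u, x < n) (hw : ∀ x ∈ w, x ≤ n) :
    fast (u ++ n :: w) = fast u ++ fast w ++ [n] := by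
  have hn : n ∉ u := fun h => lt_irrefl n (hu n h)
  have hle : ∀ x ∈ u ++ n :: w, x ≤ n := by
    simp only [List.mem_append, List.mem_cons]
    rintro x (hx | rfl | hx)
    exacts [(hu x hx).le, le_rfl, hw x hx]
  rw [fast_eq_of_forall_le hle, fast_eq_of_forall_le hw, blocks_append_cons hn]
  simp [List.count_eq_zero_of_not_mem hn, List.replicate_succ']

lemma BTree.WeaklyDecreasing.forall_lt {t : BTree} (ht : t.WeaklyDecreasing) {n : ℕ}
    (hle : ∀ x ∈ t.inOrder, x ≤ n) (hroot : t.root? ≠ some n) : ∀ x ∈ t.inOrder, x < n := by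
  cases t with
  | leaf => simp [BTree.inOrder]
  | node l v r =>
    have hv : v < n :=
      lt_of_le_of_ne (hle v (by simp [BTree.inOrder])) (by simpa [BTree.root?] using hroot)
    simp only [BTree.inOrder, List.mem_append, List.mem_cons]
    rintro x (hx | rfl | hx)
    exacts [(ht.1 x hx).trans_lt hv, hv, (ht.2.1 x hx).trans_lt hv]

/-- For every tree `τ ∈ R` (a weakly decreasing binary plane tree in which no vertex
has the same label as its left child), applying `fast` to the in-order reading of `τ`
yields the postorder reading of `τ`. -/
theorem fast_inOrder_eq_postOrder (t : BTree) (ht : t.InR) :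
    fast t.inOrder = t.postOrder := by
  induction t with
  | leaf => simp [BTree.inOrder, BTree.postOrder, fast]
  | node l v r ihl ihr =>
    obtain ⟨⟨hl, hr, hdl, hdr⟩, ⟨-, hpl, hpr⟩, hroot, hnl, hnr⟩ := ht
    rw [BTree.inOrder, BTree.postOrder, fast_append_cons (hdl.forall_lt hl hroot) hr,
      ihl ⟨hdl, hpl, hnl⟩, ihr ⟨hdr, hpr, hnr⟩]
end
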